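/- The functions γ_i^{(2)}(z) = −1/(z(1 + (1/n)Tr(D̃_i Υ̃(z)))) for 1 ≤ i ≤ N and γ̃_j^{(2)}(z) = −1/(z(1 + (1/n)Tr(D_j Υ(z)))) for 1 ≤ j ≤ n are well defined and analytic on ℂ ∖ ℝ+ and belong to S(ℝ+). -/

import Mathlib

open MeasureTheory Matrix Complex Filter
open scoped Topology ComplexOrder

noncomputable section

/-- The set `ℂ ∖ ℝ₊`. -/
def offRplus : Set ℂ := {z : ℂ | ¬ (z.im = 0 ∧ 0 ≤ z.re)}

/-- `f` is the Stieltjes transform of a probability measure carried by `ℝ₊`. -/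
def IsStieltjesPM (f : ℂ → ℂ) : Prop :=
  ∃ μ : Measure ℝ, IsProbabilityMeasure μ ∧ μ (Set.Iio 0) = 0 ∧
    ∀ z ∈ offRplus, f z = ∫ t, ((t : ℂ) - z)⁻¹ ∂μ
def Tmat {N n : ℕ} (A : Matrix (Fin N) (Fin n) ℝ)
    (ψ : Fin N → ℂ → ℂ) (ψt : Fin n → ℂ → ℂ) (z : ℂ) : Matrix (Fin N) (Fin N) ℂ :=
  ((Matrix.diagonal fun i => ψ i z)⁻¹
    - z • (A.map Complex.ofReal * Matrix.diagonal (fun j => ψt j z) * (A.map Complex.ofReal)ᵀ))⁻¹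

def Ttmat {N n : ℕ} (A : Matrix (Fin N) (Fin n) ℝ)
    (ψ : Fin N → ℂ → ℂ) (ψt : Fin n → ℂ → ℂ) (z : ℂ) : Matrix (Fin n) (Fin n) ℂ :=
  ((Matrix.diagonal fun j => ψt j z)⁻¹
    - z • ((A.map Complex.ofReal)ᵀ * Matrix.diagonal (fun i => ψ i z) * A.map Complex.ofReal))⁻¹

def SolvesSystem {N n : ℕ} (σ : Fin N → Fin n → ℝ) (A : Matrix (Fin N) (Fin n) ℝ)
    (ψ : Fin N → ℂ → ℂ) (ψt : Fin n → ℂ → ℂ) : Prop :=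
  (∀ i, IsStieltjesPM (ψ i)) ∧ (∀ j, IsStieltjesPM (ψt j)) ∧
  ∀ z ∈ offRplus,
    (∀ i, ψ i z
      = -(z * (1 + (n : ℂ)⁻¹
          * ((Matrix.diagonal fun j => ((σ i j : ℂ))^2) * Ttmat A ψ ψt z).trace))⁻¹) ∧
    (∀ j, ψt j z
      = -(z * (1 + (n : ℂ)⁻¹
          * ((Matrix.diagonal fun i => ((σ i j : ℂ))^2) * Tmat A ψ ψt z).trace))⁻¹)


lemma off_ne {z : ℂ} (hz : z ∈ offRplus) {t : ℝ} (ht : 0 ≤ t) : (t : ℂ) - z ≠ 0 := by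
  intro h
  apply hz
  have : z = (t : ℂ) := (sub_eq_zero.mp h).symm
  subst this
  simpa using ht

lemma off_bound {z : ℂ} (hz : z ∈ offRplus) :
    ∃ C : ℝ, ∀ t : ℝ, 0 ≤ t → ‖((t : ℂ) - z)⁻¹‖ ≤ C := by
  have hcl : IsClosed (Complex.ofReal '' Set.Ici (0 : ℝ)) :=
    (Complex.isometry_ofReal.isClosedEmbedding).isClosedMap _ isClosed_Ici
  have hne : (Complex.ofReal '' Set.Ici (0 : ℝ)).Nonempty := ⟨0, 0, by simp⟩
  have hz' : z ∉ Complex.ofReal '' Set.Ici (0 : ℝ) := by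
    rintro ⟨t, ht, rfl⟩
    exact off_ne hz ht (by simp)
  have hpos := (hcl.notMem_iff_infDist_pos hne).mp hz'
  refine ⟨(Metric.infDist z (Complex.ofReal '' Set.Ici (0 : ℝ)))⁻¹, fun t ht => ?_⟩
  rw [norm_inv]
  apply inv_anti₀ hpos
  have := Metric.infDist_le_dist_of_mem (x := z) (Set.mem_image_of_mem Complex.ofReal ht)
  rwa [dist_comm, dist_eq_norm] at this

lemma ae_nonneg_of {μ : Measure ℝ} (h : μ (Set.Iio 0) = 0) : ∀ᵐ t ∂μ, 0 ≤ t := by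
  rw [ae_iff]
  convert h using 2
  ext t; simp

lemma int_res {μ : Measure ℝ} [IsProbabilityMeasure μ] (h : μ (Set.Iio 0) = 0) {z : ℂ}
    (hz : z ∈ offRplus) : Integrable (fun t : ℝ => ((t : ℂ) - z)⁻¹) μ := by
  obtain ⟨C, hC⟩ := off_bound hz
  refine Integrable.of_bound (C := C) ?_ ?_
  · exact (by fun_prop : Measurable (fun t : ℝ => ((t : ℂ) - z)⁻¹)).aestronglyMeasurable
  · filter_upwards [ae_nonneg_of h] with t ht using hC t ht

lemma re_mul_int {μ : Measure ℝ} [IsProbabilityMeasure μ] (h : μ (Set.Iio 0) = 0) {z : ℂ}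
    (hz : z ∈ offRplus) (c : ℂ) :
    (c * ∫ t, ((t : ℂ) - z)⁻¹ ∂μ).re = ∫ t : ℝ, (c * ((t : ℂ) - z)⁻¹).re ∂μ := by
  rw [← integral_const_mul]
  exact (integral_re ((int_res h hz).const_mul c)).symm

lemma St_re_nonneg {f : ℂ → ℂ} (hf : IsStieltjesPM f) {z : ℂ} (hz : z ∈ offRplus) (c : ℂ)
    (hc : ∀ t : ℝ, 0 ≤ t → 0 ≤ (c * ((t : ℂ) - z)⁻¹).re) : 0 ≤ (c * f z).re := by
  obtain ⟨μ, hμ, h0, hE⟩ := hf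
  rw [hE z hz, re_mul_int h0 hz]
  apply integral_nonneg_of_ae
  filter_upwards [ae_nonneg_of h0] with t ht using hc t ht

lemma St_re_pos {f : ℂ → ℂ} (hf : IsStieltjesPM f) {z : ℂ} (hz : z ∈ offRplus) (c : ℂ)
    (hc : ∀ t : ℝ, 0 ≤ t → 0 < (c * ((t : ℂ) - z)⁻¹).re) : 0 < (c * f z).re := by
  obtain ⟨μ, hμ, h0, hE⟩ := hf
  rw [hE z hz, re_mul_int h0 hz]
  have hi : Integrable (fun t : ℝ => (c * ((t : ℂ) - z)⁻¹).re) μ :=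
    ((int_res h0 hz).const_mul c).re
  have hp : ∀ᵐ t : ℝ ∂μ, 0 < (c * ((t : ℂ) - z)⁻¹).re := by
    filter_upwards [ae_nonneg_of h0] with t ht using hc t ht
  rw [integral_pos_iff_support_of_nonneg_ae (hp.mono fun t ht => ht.le) hi]
  rw [pos_iff_ne_zero]
  intro h
  have h2 : ∀ᵐ t ∂μ, t ∉ Function.support (fun t : ℝ => (c * ((t : ℂ) - z)⁻¹).re) :=
    measure_eq_zero_iff_ae_notMem.mp h
  obtain ⟨t, ht1, ht2⟩ := (hp.and h2).exists
  exact ht2 ht1.ne'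

lemma exists_sign {z : ℂ} (hz : z ∈ offRplus) :
    ∃ c : ℂ, ∀ f, IsStieltjesPM f → 0 < (c * (f z)⁻¹).re ∧ 0 ≤ (-(c * z) * f z).re ∧ f z ≠ 0 := by
  have key : ∃ c : ℂ, ∀ t : ℝ, 0 ≤ t → 0 < (star c * ((t : ℂ) - z)⁻¹).re ∧
      0 ≤ (-(c * z) * ((t : ℂ) - z)⁻¹).re := by
    have hns : ∀ t : ℝ, 0 ≤ t → 0 < Complex.normSq ((t : ℂ) - z) := fun t ht =>
      Complex.normSq_pos.mpr (off_ne hz ht)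
    rcases lt_trichotomy z.im 0 with h | h | h
    · refine ⟨-I, fun t ht => ?_⟩
      have := hns t ht
      constructor
      · have e : (star (-I) * ((t : ℂ) - z)⁻¹).re = -z.im / Complex.normSq ((t : ℂ) - z) := by
          simp [Complex.inv_re, Complex.inv_im, Complex.mul_re]
          ring
        rw [e]; apply div_pos _ this; linarith
      · have e : (-(-I * z) * ((t : ℂ) - z)⁻¹).re = t * -z.im / Complex.normSq ((t : ℂ) - z) := by
          simp [Complex.inv_re, Complex.inv_im, Complex.mul_re]
          ring
        rw [e]; apply div_nonneg _ this.le; apply mul_nonneg ht; linarith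
    · have hr : z.re < 0 := by
        by_contra hh
        exact hz ⟨h, not_lt.mp hh⟩
      refine ⟨1, fun t ht => ?_⟩
      have := hns t ht
      constructor
      · have e : (star (1:ℂ) * ((t : ℂ) - z)⁻¹).re = (t - z.re) / Complex.normSq ((t : ℂ) - z) := by
          simp [Complex.inv_re]
        rw [e]; apply div_pos _ this; linarith
      · have e : (-(1 * z) * ((t : ℂ) - z)⁻¹).re
            = -z.re * (t - z.re) / Complex.normSq ((t : ℂ) - z) := by
          simp [Complex.inv_re, Complex.inv_im, Complex.mul_re, h]
          ring
        rw [e]; apply div_nonneg _ this.le; apply mul_nonneg <;> linarith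
    · refine ⟨I, fun t ht => ?_⟩
      have := hns t ht
      constructor
      · have e : (star I * ((t : ℂ) - z)⁻¹).re = z.im / Complex.normSq ((t : ℂ) - z) := by
          simp [Complex.inv_re]
        rw [e]; apply div_pos _ this; linarith
      · have e : (-(I * z) * ((t : ℂ) - z)⁻¹).re = t * z.im / Complex.normSq ((t : ℂ) - z) := by
          simp [Complex.inv_re, Complex.inv_im, Complex.mul_re]
          ring
        rw [e]; apply div_nonneg _ this.le; apply mul_nonneg ht; linarith
  obtain ⟨c, hc⟩ := key
  refine ⟨c, fun f hf => ?_⟩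
  have h1 := St_re_pos hf hz (star c) (fun t ht => (hc t ht).1)
  have h2 := St_re_nonneg hf hz (-(c * z)) (fun t ht => (hc t ht).2)
  have h3 : f z ≠ 0 := by
    intro h; rw [h] at h1; simp at h1
  refine ⟨?_, h2, h3⟩
  have e : (c * (f z)⁻¹).re = (star c * f z).re / Complex.normSq (f z) := by
    simp [Complex.inv_re, Complex.inv_im, Complex.mul_re]
    ring
  rw [e]
  exact div_pos h1 (Complex.normSq_pos.mpr h3)

lemma diag_inv {m : ℕ} (g : Fin m → ℂ) (hg : ∀ j, g j ≠ 0) :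
    (Matrix.diagonal g)⁻¹ = Matrix.diagonal (fun j => (g j)⁻¹) := by
  apply Matrix.inv_eq_right_inv
  rw [Matrix.diagonal_mul_diagonal, ← Matrix.diagonal_one]
  congr 1; ext j; simp [hg j]

/-- the matrix whose inverse is `Ttmat`. -/
def preMat {N n : ℕ} (A : Matrix (Fin N) (Fin n) ℝ) (h : Fin N → ℂ) (g : Fin n → ℂ) (z : ℂ) :
    Matrix (Fin n) (Fin n) ℂ :=
  Matrix.diagonal (fun j => (g j)⁻¹)
    - z • ((A.map Complex.ofReal)ᵀ * Matrix.diagonal h * A.map Complex.ofReal)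

lemma preMat_mulVec {N n : ℕ} (A : Matrix (Fin N) (Fin n) ℝ) (h : Fin N → ℂ) (g : Fin n → ℂ)
    (z : ℂ) (v : Fin n → ℂ) (j : Fin n) :
    (preMat A h g z *ᵥ v) j = (g j)⁻¹ * v j - z * ∑ i, (A i j : ℂ) * (h i * ∑ l, (A i l : ℂ) * v l) := by
  unfold preMat
  rw [Matrix.sub_mulVec, Matrix.smul_mulVec, ← Matrix.mulVec_mulVec, ← Matrix.mulVec_mulVec]
  simp only [Pi.sub_apply, Pi.smul_apply, smul_eq_mul, Matrix.mulVec_diagonal]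
  congr 2
  simp only [Matrix.mulVec, dotProduct, Matrix.transpose_apply, Matrix.map_apply]
  apply Finset.sum_congr rfl
  intro i _
  congr 1
  simp [Matrix.diagonal_apply]

lemma preMat_det {N n : ℕ} (A : Matrix (Fin N) (Fin n) ℝ) (h : Fin N → ℂ) (g : Fin n → ℂ)
    (z c : ℂ) (hg : ∀ j, 0 < (c * (g j)⁻¹).re) (hh : ∀ i, 0 ≤ (-(c * z) * h i).re) :
    (preMat A h g z).det ≠ 0 := by
  intro hd
  obtain ⟨v, hv, hv0⟩ := Matrix.exists_mulVec_eq_zero_iff.mpr hd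
  have e : ∑ j, star (v j) * (preMat A h g z *ᵥ v) j = 0 := by simp [hv0]
  simp_rw [preMat_mulVec] at e
  have e2 : ∑ j, star (v j) * ((g j)⁻¹ * v j - z * ∑ i, (A i j : ℂ) * (h i * ∑ l, (A i l : ℂ) * v l))
      = ∑ j, (g j)⁻¹ * (Complex.normSq (v j) : ℂ)
        - z * ∑ i, h i * (Complex.normSq (∑ l, (A i l : ℂ) * v l) : ℂ) := by
    simp_rw [mul_sub, Finset.sum_sub_distrib, Complex.normSq_eq_conj_mul_self]
    congr 1
    · apply Finset.sum_congr rfl; intro j _; simp; ring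
    · simp_rw [map_sum, map_mul, Complex.conj_ofReal, Finset.mul_sum, Finset.sum_mul]
      rw [Finset.sum_comm]
      apply Finset.sum_congr rfl; intro i _
      rw [Finset.sum_comm]
      simp_rw [Finset.mul_sum]
      apply Finset.sum_congr rfl; intro j _
      apply Finset.sum_congr rfl; intro l _
      simp; ring
  rw [e2] at e
  have e3 : (∑ j, (c * (g j)⁻¹).re * Complex.normSq (v j))
      + ∑ i, (-(c * z) * h i).re * Complex.normSq (∑ l, (A i l : ℂ) * v l) = 0 := by
    have := congrArg (fun w => (c * w).re) e
    simp only [mul_zero, Complex.zero_re] at this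
    rw [← this, mul_sub, Finset.mul_sum, Finset.mul_sum, Finset.mul_sum, sub_eq_add_neg,
      ← Finset.sum_neg_distrib, Complex.add_re, Complex.re_sum, Complex.re_sum]
    congr 1
    · apply Finset.sum_congr rfl; intro j _
      rw [← mul_assoc, Complex.re_mul_ofReal]
    · apply Finset.sum_congr rfl; intro j _
      rw [← Complex.re_mul_ofReal]; congr 1; ring
  obtain ⟨j0, hj0⟩ := Function.ne_iff.mp hv
  have p1 : 0 < ∑ j, (c * (g j)⁻¹).re * Complex.normSq (v j) := by
    apply Finset.sum_pos'
    · intro j _; exact mul_nonneg (hg j).le (Complex.normSq_nonneg _)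
    · exact ⟨j0, Finset.mem_univ _, mul_pos (hg j0) (Complex.normSq_pos.mpr hj0)⟩
  have p2 : 0 ≤ ∑ i, (-(c * z) * h i).re * Complex.normSq (∑ l, (A i l : ℂ) * v l) :=
    Finset.sum_nonneg fun i _ => mul_nonneg (hh i) (Complex.normSq_nonneg _)
  linarith

lemma Ttmat_eq {N n : ℕ} (A : Matrix (Fin N) (Fin n) ℝ)
    (γ : Fin N → ℂ → ℂ) (γt : Fin n → ℂ → ℂ) (z : ℂ) (h : ∀ j, γt j z ≠ 0) :
    Ttmat A γ γt z = (preMat A (fun i => γ i z) (fun j => γt j z) z)⁻¹ := by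
  unfold Ttmat preMat
  rw [diag_inv _ h]

lemma isSt_of_sum {ι : Type*} [Fintype ι] (w lam : ι → ℝ) (hw : ∀ k, 0 ≤ w k)
    (hl : ∀ k, 0 ≤ lam k) (h1 : ∑ k, w k = 1) :
    ∃ μ : Measure ℝ, IsProbabilityMeasure μ ∧ μ (Set.Iio 0) = 0 ∧
      ∀ F : ℝ → ℂ, Measurable F → ∫ t, F t ∂μ = ∑ k, (w k : ℂ) * F (lam k) := by
  refine ⟨∑ k, ENNReal.ofReal (w k) • Measure.dirac (lam k), ⟨?_⟩, ?_, ?_⟩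
  · simp only [Measure.coe_finsetSum, Finset.sum_apply, Measure.smul_apply, measure_univ,
      smul_eq_mul, mul_one]
    rw [← ENNReal.ofReal_sum_of_nonneg (fun k _ => hw k), h1, ENNReal.ofReal_one]
  · simp only [Measure.coe_finsetSum, Finset.sum_apply, Measure.smul_apply]
    apply Finset.sum_eq_zero
    intro k _
    rw [Measure.dirac_apply' _ measurableSet_Iio]
    simp [hl k]
  · intro F hF
    rw [integral_finsetSum_measure]
    · apply Finset.sum_congr rfl
      intro k _
      rw [integral_smul_measure, integral_dirac, ENNReal.toReal_ofReal (hw k)]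
      simp
    · intro k _
      apply Integrable.smul_measure _ ENNReal.ofReal_ne_top
      exact integrable_dirac (by simp)

lemma spectral_lem {ι : Type*} [Fintype ι] [DecidableEq ι] (H : Matrix ι ι ℂ) (hH : H.PosSemidef)
    (e : ι → ℂ) (he : star e ⬝ᵥ e = 1) :
    ∃ μ : Measure ℝ, IsProbabilityMeasure μ ∧ μ (Set.Iio 0) = 0 ∧
      ∀ z ∈ offRplus, ∀ x : ι → ℂ, H *ᵥ x - z • x = e →
        star e ⬝ᵥ x = ∫ t, ((t : ℂ) - z)⁻¹ ∂μ := by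
  set b := hH.1.eigenvectorBasis with hb
  set lam := hH.1.eigenvalues with hlam
  have key : ∀ x y : ι → ℂ, star x ⬝ᵥ y
      = ∑ k, star (inner ℂ (b k) (WithLp.toLp 2 x)) * inner ℂ (b k) (WithLp.toLp 2 y) := by
    intro x y
    have := b.sum_inner_mul_inner (WithLp.toLp 2 x) (WithLp.toLp 2 y)
    rw [EuclideanSpace.inner_eq_star_dotProduct] at this
    rw [dotProduct_comm]
    rw [← this]
    apply Finset.sum_congr rfl
    intro k _
    rw [← inner_conj_symm]
    rfl
  have nonneg : ∀ k, 0 ≤ lam k := hH.eigenvalues_nonneg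
  have hin : ∀ k (x : ι → ℂ), inner ℂ (b k) (WithLp.toLp 2 (H *ᵥ x))
      = (lam k : ℂ) * inner ℂ (b k) (WithLp.toLp 2 x) := by
    intro k x
    have h1 : inner ℂ (b k) (WithLp.toLp 2 (H *ᵥ x)) = (H *ᵥ x) ⬝ᵥ star (b k).ofLp := by
      rw [EuclideanSpace.inner_eq_star_dotProduct]
    have h2 : inner ℂ (b k) (WithLp.toLp 2 x) = x ⬝ᵥ star (b k).ofLp := by
      rw [EuclideanSpace.inner_eq_star_dotProduct]
    rw [h1, h2]
    have h3 := hH.1.mulVec_eigenvectorBasis k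
    rw [dotProduct_comm, Matrix.dotProduct_mulVec]
    have h4 : star (b k).ofLp ᵥ* H = star (H *ᵥ (b k).ofLp) := by
      rw [Matrix.star_mulVec, hH.1.eq]
    rw [h4]
    have h5 : H *ᵥ (b k).ofLp = (lam k) • (b k).ofLp := h3
    rw [h5, star_smul, smul_dotProduct, dotProduct_comm]
    simp
  obtain ⟨μ, hμ, h0, hF⟩ := isSt_of_sum
    (fun k => Complex.normSq (inner ℂ (b k) (WithLp.toLp 2 e))) lam
    (fun k => Complex.normSq_nonneg _) nonneg (by
      have := key e e
      rw [he] at this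
      have h2 : ((∑ k, Complex.normSq (inner ℂ (b k) (WithLp.toLp 2 e)) : ℝ) : ℂ) = 1 := by
        rw [this]
        push_cast
        apply Finset.sum_congr rfl
        intro k _
        rw [Complex.normSq_eq_conj_mul_self]; rfl
      exact_mod_cast h2)
  refine ⟨μ, hμ, h0, fun z hz x hx => ?_⟩
  rw [hF _ (by fun_prop), key]
  apply Finset.sum_congr rfl
  intro k _
  have hne := off_ne hz (nonneg k)
  have h1 : inner ℂ (b k) (WithLp.toLp 2 e)
      = ((lam k : ℂ) - z) * inner ℂ (b k) (WithLp.toLp 2 x) := by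
    rw [← hx, WithLp.toLp_sub, WithLp.toLp_smul, inner_sub_right, inner_smul_right, hin]
    ring
  have h2 : inner ℂ (b k) (WithLp.toLp 2 x)
      = ((lam k : ℂ) - z)⁻¹ * inner ℂ (b k) (WithLp.toLp 2 e) := by
    rw [h1]; field_simp
  rw [h2, Complex.normSq_eq_conj_mul_self]
  simp only [RCLike.star_def]
  ring

lemma discrete_lem {N n : ℕ} {K : Type*} [Fintype K] [DecidableEq K]
    (A : Matrix (Fin N) (Fin n) ℝ) (lam : K → ℝ) (hl : ∀ k, 0 ≤ lam k)
    (p : Fin N → K → ℝ) (hp : ∀ i k, 0 ≤ p i k)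
    (q : Fin n → K → ℝ) (hq : ∀ i k, 0 ≤ q i k) (hq1 : ∀ i, ∑ k, q i k = 1) (j0 : Fin n) :
    ∃ μ : Measure ℝ, IsProbabilityMeasure μ ∧ μ (Set.Iio 0) = 0 ∧
      ∀ z ∈ offRplus,
        (∀ j, ∑ k, (q j k : ℂ) * ((lam k : ℂ) - z)⁻¹ ≠ 0) → 
        ∀ y : Fin n → ℂ, preMat A (fun i => ∑ k, (p i k : ℂ) * ((lam k : ℂ) - z)⁻¹)
          (fun j => ∑ k, (q j k : ℂ) * ((lam k : ℂ) - z)⁻¹) z *ᵥ y = Pi.single j0 1 →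
        y j0 = ∫ t, ((t : ℂ) - z)⁻¹ ∂μ := by
  classical
  let L : Matrix ((Fin n × K) ⊕ (Fin N × K)) ((Fin n × K) ⊕ (Fin N × K)) ℂ :=
    Matrix.diagonal (Sum.elim (fun a => (lam a.2 : ℂ)) (fun _ => 0))
  let M : Matrix (Fin N × K) ((Fin n × K) ⊕ (Fin N × K)) ℂ :=
    Matrix.of fun b s => Sum.elim
      (fun a : Fin n × K => ((√(p b.1 b.2) * A b.1 a.1 * √(q a.1 a.2) : ℝ) : ℂ))
      (fun b' : Fin N × K => if b' = b then ((√(lam b.2) : ℝ) : ℂ) else 0) s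
  let e : (Fin n × K) ⊕ (Fin N × K) → ℂ :=
    Sum.elim (fun a => if a.1 = j0 then ((√(q a.1 a.2) : ℝ) : ℂ) else 0) (fun _ => 0)
  have sq : ∀ r : ℝ, 0 ≤ r → ((√r : ℝ) : ℂ) * ((√r : ℝ) : ℂ) = (r : ℂ) := by
    intro r hr
    rw [← Complex.ofReal_mul, Real.mul_self_sqrt hr]
  have hH : (L + Mᴴ * M).PosSemidef := by
    apply Matrix.PosSemidef.add
    · apply Matrix.PosSemidef.diagonal
      intro s
      rcases s with a | b
      · simpa using hl a.2
      · simp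
    · exact Matrix.posSemidef_conjTranspose_mul_self M
  have he : star e ⬝ᵥ e = 1 := by
    simp only [dotProduct, Fintype.sum_sum_type, e, Pi.star_apply, Sum.elim_inl, Sum.elim_inr,
      star_zero, mul_zero, Finset.sum_const_zero, add_zero, Fintype.sum_prod_type]
    rw [Finset.sum_eq_single j0]
    · simp only [if_true]
      rw [← Complex.ofReal_one, ← hq1 j0, Complex.ofReal_sum]
      apply Finset.sum_congr rfl
      intro k _
      rw [← sq _ (hq j0 k)]
      simp
    · intro j _ hj
      simp [hj]
    · simp
  obtain ⟨μ, hμ, h0, hx⟩ := spectral_lem (L + Mᴴ * M) hH e he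
  refine ⟨μ, hμ, h0, fun z hz hg y hy => ?_⟩
  have hne : ∀ k, (lam k : ℂ) - z ≠ 0 := fun k => off_ne hz (hl k)
  set h : Fin N → ℂ := fun i => ∑ k, (p i k : ℂ) * ((lam k : ℂ) - z)⁻¹ with hh
  set g : Fin n → ℂ := fun j => ∑ k, (q j k : ℂ) * ((lam k : ℂ) - z)⁻¹ with hgd
  set u : Fin N → ℂ := fun i => ∑ l, (A i l : ℂ) * y l with hu
  have hy' : ∀ j, (g j)⁻¹ * y j - z * ∑ i, (A i j : ℂ) * (h i * u i)
      = if j = j0 then 1 else 0 := by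
    intro j
    have := congrFun hy j
    rw [preMat_mulVec] at this
    rw [this, Pi.single_apply]
  let x : (Fin n × K) ⊕ (Fin N × K) → ℂ :=
    Sum.elim (fun a => ((lam a.2 : ℂ) - z)⁻¹ * ((√(q a.1 a.2) : ℝ) : ℂ) * ((g a.1)⁻¹ * y a.1))
      (fun b => -(((lam b.2 : ℂ) - z)⁻¹ * ((√(lam b.2) : ℝ) : ℂ) * ((√(p b.1 b.2) : ℝ) : ℂ) * u b.1))
  have hqx : ∀ j, ∑ k, ((√(q j k) : ℝ) : ℂ) *
      (((lam k : ℂ) - z)⁻¹ * ((√(q j k) : ℝ) : ℂ) * ((g j)⁻¹ * y j)) = y j := by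
    intro j
    have : ∀ k, ((√(q j k) : ℝ) : ℂ) *
      (((lam k : ℂ) - z)⁻¹ * ((√(q j k) : ℝ) : ℂ) * ((g j)⁻¹ * y j))
        = ((q j k : ℂ) * ((lam k : ℂ) - z)⁻¹) * ((g j)⁻¹ * y j) := by
      intro k; rw [← sq _ (hq j k)]; ring
    simp_rw [this]
    rw [← Finset.sum_mul]
    exact mul_inv_cancel_left₀ (hg j) _
  have hMx : ∀ b : Fin N × K, (M *ᵥ x) b
      = -z * ((lam b.2 : ℂ) - z)⁻¹ * ((√(p b.1 b.2) : ℝ) : ℂ) * u b.1 := by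
    intro b
    simp only [Matrix.mulVec, dotProduct, Fintype.sum_sum_type, M, x, Matrix.of_apply,
      Sum.elim_inl, Sum.elim_inr, ite_mul, zero_mul, Finset.sum_ite_eq', Finset.mem_univ, if_true,
      Fintype.sum_prod_type (f := fun a : Fin n × K => _)]
    have h1 : ∑ j, ∑ k, ((√(p b.1 b.2) * A b.1 j * √(q j k) : ℝ) : ℂ) *
        (((lam k : ℂ) - z)⁻¹ * ((√(q j k) : ℝ) : ℂ) * ((g j)⁻¹ * y j))
        = ((√(p b.1 b.2) : ℝ) : ℂ) * u b.1 := by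
      rw [hu, Finset.mul_sum]
      apply Finset.sum_congr rfl
      intro j _
      conv_rhs => rw [← hqx j]
      rw [Finset.mul_sum, Finset.mul_sum]
      apply Finset.sum_congr rfl
      intro k _
      push_cast
      ring
    rw [h1]
    have h2 := sq _ (hl b.2)
    have h3 := hne b.2
    field_simp
    linear_combination (-((√(p b.1 b.2) : ℝ) : ℂ) * u b.1) * h2
  have hfin := hx z hz x (by
    ext s
    simp only [Pi.sub_apply, Pi.smul_apply, smul_eq_mul, Matrix.add_mulVec, Pi.add_apply,
      ← Matrix.mulVec_mulVec]
    have hD : (L *ᵥ x) s = Sum.elim (fun a => (lam a.2 : ℂ)) (fun _ => 0) s * x s := by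
      simp only [L, Matrix.mulVec_diagonal]
    rw [hD]
    have hM2 : (Mᴴ *ᵥ (M *ᵥ x)) s = ∑ b, star (M b s) * (M *ᵥ x) b := by
      simp [Matrix.mulVec, dotProduct, Matrix.conjTranspose_apply]
    rw [hM2]
    simp_rw [hMx]
    rcases s with ⟨j, k⟩ | ⟨i, k⟩
    · simp only [Sum.elim_inl, M, x, e, Matrix.of_apply, Fintype.sum_prod_type]
      have h1 : ∑ i, ∑ l, star (((√(p i l) * A i j * √(q j k) : ℝ) : ℂ)) *
          (-z * ((lam l : ℂ) - z)⁻¹ * ((√(p i l) : ℝ) : ℂ) * u i)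
          = ((√(q j k) : ℝ) : ℂ) * (- (z * ∑ i, (A i j : ℂ) * (h i * u i))) := by
        rw [Finset.mul_sum, ← Finset.sum_neg_distrib, Finset.mul_sum]
        apply Finset.sum_congr rfl
        intro i _
        rw [hh]
        simp only
        rw [Finset.sum_mul, Finset.mul_sum, Finset.mul_sum, ← Finset.sum_neg_distrib,
          Finset.mul_sum]
        apply Finset.sum_congr rfl
        intro l _
        rw [← sq _ (hp i l)]
        simp only [RCLike.star_def, Complex.conj_ofReal]
        push_cast
        ring
      rw [h1]
      have h2 := hy' j
      have h3 := hne k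
      have h4 : -(z * ∑ i, (A i j : ℂ) * (h i * u i)) = (if j = j0 then 1 else 0) - (g j)⁻¹ * y j := by
        rw [← h2]; ring
      rw [h4]
      split_ifs
      · field_simp
        ring
      · field_simp
        ring
    · simp only [Sum.elim_inr, M, x, e, Matrix.of_apply]
      have h1 : ∀ b : Fin N × K, star (if (i, k) = b then ((√(lam b.2) : ℝ) : ℂ) else 0) *
          (-z * ((lam b.2 : ℂ) - z)⁻¹ * ((√(p b.1 b.2) : ℝ) : ℂ) * u b.1)
          = if (i, k) = b then ((√(lam b.2) : ℝ) : ℂ) *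
          (-z * ((lam b.2 : ℂ) - z)⁻¹ * ((√(p b.1 b.2) : ℝ) : ℂ) * u b.1) else 0 := by
        intro b
        split_ifs
        · simp
        · simp
      simp_rw [h1]
      rw [Finset.sum_ite_eq]
      simp only [Finset.mem_univ, if_true]
      ring)
  rw [← hfin]
  simp only [dotProduct, Fintype.sum_sum_type, e, x, Pi.star_apply, Sum.elim_inl, Sum.elim_inr,
      star_zero, zero_mul, Finset.sum_const_zero, add_zero, Fintype.sum_prod_type]
  rw [Finset.sum_eq_single j0]
  · simp only [if_true]
    conv_lhs => rw [← hqx j0]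
    apply Finset.sum_congr rfl
    intro k _
    simp
  · intro j _ hj
    simp [hj]
  · simp

lemma St_asymp {f : ℂ → ℂ} (hf : IsStieltjesPM f) :
    Tendsto (fun m : ℕ => ((m : ℂ) + 1) * f (-((m : ℂ) + 1))) atTop (𝓝 1) := by
  obtain ⟨μ, hμ, h0, hE⟩ := hf
  have hoff : ∀ m : ℕ, -((m : ℂ) + 1) ∈ offRplus := by
    intro m h
    have := h.2
    simp at this
    have h2 : (0 : ℝ) ≤ m := Nat.cast_nonneg m
    linarith
  have e : ∀ m : ℕ, ((m : ℂ) + 1) * f (-((m : ℂ) + 1))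
      = ∫ t : ℝ, ((m : ℂ) + 1) * ((t : ℂ) - (-((m : ℂ) + 1)))⁻¹ ∂μ := by
    intro m
    rw [hE _ (hoff m), integral_const_mul]
  simp_rw [e]
  have hn : ∀ (m : ℕ) (t : ℝ), ((m : ℂ) + 1) * ((t : ℂ) - (-((m : ℂ) + 1)))⁻¹
      = ((((m : ℝ) + 1) / (t + ((m : ℝ) + 1)) : ℝ) : ℂ) := by
    intro m t
    push_cast
    rw [div_eq_mul_inv]
    congr 2
    ring
  have h1 : ∫ _ : ℝ, (1 : ℂ) ∂μ = 1 := by simp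
  suffices hs : Tendsto (fun m : ℕ => ∫ t : ℝ, ((m : ℂ) + 1) * ((t : ℂ) - (-((m : ℂ) + 1)))⁻¹ ∂μ)
      atTop (𝓝 (∫ _ : ℝ, (1 : ℂ) ∂μ)) by rwa [h1] at hs
  apply tendsto_integral_of_dominated_convergence (fun _ => (1 : ℝ))
  · intro m
    exact (by fun_prop : Measurable (fun t : ℝ =>
      ((m : ℂ) + 1) * ((t : ℂ) - (-((m : ℂ) + 1)))⁻¹)).aestronglyMeasurable
  · exact integrable_const _
  · intro m
    filter_upwards [ae_nonneg_of h0] with t ht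
    have h2 : (0 : ℝ) ≤ m := Nat.cast_nonneg m
    rw [hn, Complex.norm_real, Real.norm_eq_abs, abs_of_nonneg (by positivity)]
    rw [div_le_one (by positivity)]
    linarith
  · filter_upwards [ae_nonneg_of h0] with t ht
    simp_rw [hn]
    rw [← Complex.ofReal_one]
    apply (Complex.continuous_ofReal.tendsto 1).comp
    have h3 : ∀ m : ℕ, ((m : ℝ) + 1) / (t + ((m : ℝ) + 1)) = 1 - t / (t + ((m : ℝ) + 1)) := by
      intro m
      have h2 : (0 : ℝ) ≤ m := Nat.cast_nonneg m
      have : t + ((m : ℝ) + 1) ≠ 0 := by positivity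
      field_simp
      ring
    simp_rw [h3]
    have h4 : Tendsto (fun m : ℕ => t / (t + ((m : ℝ) + 1))) atTop (𝓝 0) := by
      apply Tendsto.const_div_atTop
      apply tendsto_atTop_add_const_left
      exact tendsto_atTop_add_const_right _ _ tendsto_natCast_atTop_atTop
    simpa using tendsto_const_nhds.sub h4

lemma den_ne {z : ℂ} (hz : z ∈ offRplus) {s : ℝ} (h0 : 0 ≤ s) (h1 : s ≤ 1) :
    1 - (s : ℂ) - s * z ≠ 0 := by
  intro h
  rcases h0.eq_or_lt with h2 | h2
  · rw [← h2] at h; simp at h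
  · have h3 : (s : ℂ) ≠ 0 := by exact_mod_cast h2.ne'
    have : (((1 - s) / s : ℝ) : ℂ) - z = 0 := by
      push_cast
      field_simp
      linear_combination h
    exact off_ne hz (div_nonneg (by linarith) h0) this

/-- limits of Stieltjes transforms -/
lemma St_limit {f : ℕ → ℂ → ℂ} {g : ℂ → ℂ} (hf : ∀ m, IsStieltjesPM (f m))
    (hlim : ∀ z ∈ offRplus, Tendsto (fun m => f m z) atTop (𝓝 (g z)))
    (hg : Tendsto (fun m : ℕ => ((m : ℂ) + 1) * g (-((m : ℂ) + 1))) atTop (𝓝 1)) :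
    IsStieltjesPM g := by
  choose μ hμ h0 hE using hf
  let T : ℝ → unitInterval := fun t => Set.projIcc 0 1 zero_le_one (1 + t)⁻¹
  have hT : Measurable T := by
    apply continuous_projIcc.measurable.comp
    fun_prop
  have hTv : ∀ t : ℝ, 0 ≤ t → ((T t : unitInterval) : ℝ) = (1 + t)⁻¹ := by
    intro t ht
    simp only [T]
    rw [Set.projIcc_of_mem zero_le_one (x := (1 + t)⁻¹) ⟨by positivity, inv_le_one_of_one_le₀ (by linarith)⟩]
  let ν : ℕ → ProbabilityMeasure unitInterval := fun m =>
    ⟨(μ m).map T, Measure.isProbabilityMeasure_map hT.aemeasurable⟩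
  let U : Ultrafilter ℕ := Ultrafilter.of atTop
  have hU : (U : Filter ℕ) ≤ atTop := Ultrafilter.of_le _
  obtain ⟨ρ, hρ⟩ : ∃ ρ : ProbabilityMeasure unitInterval, Tendsto ν U (𝓝 ρ) :=
    ⟨_, (U.map ν).le_nhds_lim⟩
  let Fz : ℂ → unitInterval → ℂ := fun z s => (s : ℝ) * (1 - ((s : ℝ) : ℂ) - (s : ℝ) * z)⁻¹
  have hFc : ∀ z ∈ offRplus, Continuous (Fz z) := by
    intro z hz
    apply Continuous.mul (by fun_prop)
    apply Continuous.inv₀ (by fun_prop)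
    intro s
    exact den_ne hz s.2.1 s.2.2
  have hFT : ∀ z ∈ offRplus, ∀ t : ℝ, 0 ≤ t → Fz z (T t) = ((t : ℂ) - z)⁻¹ := by
    intro z hz t ht
    simp only [Fz, hTv t ht]
    have h1 : (1 : ℂ) + t ≠ 0 := by
      have : (1 : ℝ) + t ≠ 0 := by positivity
      exact_mod_cast this
    have h2 := off_ne hz ht
    push_cast
    have h3 : 1 - (1 + (t : ℂ))⁻¹ - (1 + (t : ℂ))⁻¹ * z = (1 + (t : ℂ))⁻¹ * (t - z) := by
      field_simp
      ring
    rw [h3, mul_inv, inv_inv, ← mul_assoc, inv_mul_cancel₀ h1, one_mul]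
  have hrep : ∀ z ∈ offRplus, g z = ∫ s, Fz z s ∂(ρ : Measure unitInterval) := by
    intro z hz
    have h1 := (ProbabilityMeasure.tendsto_iff_forall_integral_rclike_tendsto ℂ).mp hρ
      (BoundedContinuousFunction.mkOfCompact ⟨Fz z, hFc z hz⟩)
    refine tendsto_nhds_unique ((hlim z hz).mono_left hU) ?_
    refine Tendsto.congr ?_ h1
    intro m
    rw [hE m z hz]
    simp only [ν, ProbabilityMeasure.coe_mk, BoundedContinuousFunction.mkOfCompact_apply,
      ContinuousMap.coe_mk]
    rw [integral_map hT.aemeasurable (hFc z hz).measurable.aestronglyMeasurable]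
    apply integral_congr_ae
    filter_upwards [ae_nonneg_of (h0 m)] with t ht using hFT z hz t ht
  have hρ0 : (ρ : Measure unitInterval) {0} = 0 := by
    have hoff : ∀ m : ℕ, -((m : ℂ) + 1) ∈ offRplus := by
      intro m h
      have := h.2
      simp at this
      have h2 : (0 : ℝ) ≤ m := Nat.cast_nonneg m
      linarith
    have hlim2 : Tendsto (fun m : ℕ => ((m : ℂ) + 1) * g (-((m : ℂ) + 1))) atTop
        (𝓝 (∫ s, (({0}ᶜ : Set unitInterval).indicator (fun _ => (1 : ℂ)) s)
          ∂(ρ : Measure unitInterval))) := by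
      have e : ∀ m : ℕ, ((m : ℂ) + 1) * g (-((m : ℂ) + 1))
          = ∫ s : unitInterval, ((m : ℂ) + 1) * Fz (-((m : ℂ) + 1)) s
            ∂(ρ : Measure unitInterval) := by
        intro m
        rw [hrep _ (hoff m), integral_const_mul]
      simp_rw [e]
      have hn : ∀ (m : ℕ) (s : unitInterval), ((m : ℂ) + 1) * Fz (-((m : ℂ) + 1)) s
          = (((s : ℝ) * ((m : ℝ) + 1) / (1 + (s : ℝ) * m) : ℝ) : ℂ) := by
        intro m s
        simp only [Fz]
        push_cast
        rw [div_eq_mul_inv, ← mul_assoc, mul_comm ((m : ℂ) + 1)]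
        congr 2
        ring
      apply tendsto_integral_of_dominated_convergence (fun _ => (1 : ℝ))
      · intro m
        exact ((hFc _ (hoff m)).measurable.const_mul _).aestronglyMeasurable
      · exact integrable_const _
      · intro m
        filter_upwards with s
        have h2 : (0 : ℝ) ≤ m := Nat.cast_nonneg m
        have h3 := s.2.1
        have h4 := s.2.2
        have h5 : 0 ≤ (s : ℝ) * m := mul_nonneg h3 h2
        rw [hn, Complex.norm_real, Real.norm_eq_abs, abs_of_nonneg (by positivity)]
        rw [div_le_one (by positivity)]
        nlinarith
      · filter_upwards with s
        simp_rw [hn]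
        by_cases hs : s = 0
        · subst hs
          simp
        · have hs' : (0 : ℝ) < s := lt_of_le_of_ne s.2.1 (fun h => hs (Subtype.ext h.symm))
          rw [Set.indicator_of_mem (by simpa using hs)]
          rw [← Complex.ofReal_one]
          apply (Complex.continuous_ofReal.tendsto 1).comp
          have h3 : ∀ m : ℕ, (s : ℝ) * ((m : ℝ) + 1) / (1 + (s : ℝ) * m)
              = 1 + ((s : ℝ) - 1) / (1 + (s : ℝ) * m) := by
            intro m
            have h2 : (0 : ℝ) ≤ m := Nat.cast_nonneg m
            have : 1 + (s : ℝ) * m ≠ 0 := by positivity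
            field_simp
            ring
          simp_rw [h3]
          have h4 : Tendsto (fun m : ℕ => ((s : ℝ) - 1) / (1 + (s : ℝ) * m)) atTop (𝓝 0) := by
            apply Tendsto.const_div_atTop
            apply tendsto_atTop_add_const_left
            exact Tendsto.const_mul_atTop hs' tendsto_natCast_atTop_atTop
          simpa using tendsto_const_nhds.add h4
    have h1 := tendsto_nhds_unique hg hlim2
    rw [integral_indicator (measurableSet_singleton _).compl] at h1
    simp only [integral_const, Measure.restrict_apply MeasurableSet.univ, Set.univ_inter,
      measureReal_def] at h1
    have h2 : ((ρ : Measure unitInterval) {0}ᶜ).toReal = 1 := by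
      have := congrArg Complex.re h1
      simpa using this.symm
    have h3 : (ρ : Measure unitInterval) {0}ᶜ = 1 := by
      rw [← ENNReal.toReal_eq_one_iff]; exact h2
    have := (prob_compl_eq_one_iff (μ := (ρ : Measure unitInterval))
      (measurableSet_singleton (0 : unitInterval))).mp h3
    exact this
  let V : unitInterval → ℝ := fun s => (s : ℝ)⁻¹ - 1
  have hV : Measurable V := by fun_prop
  have hV0 : ∀ s, s ≠ 0 → 0 ≤ V s := by
    intro s hs
    have hs' : (0 : ℝ) < s := lt_of_le_of_ne s.2.1 (fun h => hs (Subtype.ext h.symm))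
    have := (one_le_inv₀ hs').mpr s.2.2
    simp only [V]; linarith
  have hae : ∀ᵐ s ∂(ρ : Measure unitInterval), s ≠ 0 := by
    rw [ae_iff]
    simpa using hρ0
  refine ⟨(ρ : Measure unitInterval).map V, Measure.isProbabilityMeasure_map hV.aemeasurable,
    ?_, ?_⟩
  · rw [Measure.map_apply hV measurableSet_Iio]
    apply measure_mono_null _ hρ0
    intro s hs
    by_contra h
    exact absurd (hV0 s h) (not_le.mpr hs)
  · intro z hz
    rw [hrep z hz, integral_map hV.aemeasurable
      (by fun_prop : Measurable (fun t : ℝ => ((t : ℂ) - z)⁻¹)).aestronglyMeasurable]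
    apply integral_congr_ae
    filter_upwards [hae] with s hs
    rw [← hFT z hz _ (hV0 s hs)]
    congr 1
    apply Subtype.ext
    rw [hTv _ (hV0 s hs)]
    simp [V]

lemma St_diff {f : ℂ → ℂ} (hf : IsStieltjesPM f) : DifferentiableOn ℂ f offRplus := by
  obtain ⟨μ, hμ, h0, hE⟩ := hf
  have h1 : DifferentiableOn ℂ (fun z : ℂ => ∫ t : ℝ, ((t : ℂ) - z)⁻¹ ∂μ) offRplus := by
    intro z hz
    have hs : z ∉ algebraMap ℝ ℂ '' μ.support := by
      rintro ⟨t, ht, rfl⟩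
      by_cases h : 0 ≤ t
      · exact off_ne hz h (by simp)
      · rw [Measure.mem_support_iff_forall] at ht
        have := ht (Set.Iio 0) (Iio_mem_nhds (not_le.mp h))
        rw [h0] at this
        exact lt_irrefl _ this
    have h2 := hasDerivAt_resolventTransform (A := ℂ) z hs
    have h3 : (resolventTransform μ : ℂ → ℂ) = fun z : ℂ => ∫ t : ℝ, ((t : ℂ) - z)⁻¹ ∂μ := by
      ext w
      simp [resolventTransform_def, resolvent, Ring.inverse_eq_inv']
    rw [h3] at h2
    exact h2.differentiableAt.differentiableWithinAt
  exact h1.congr hE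

/-- simple functions approximating the identity on the half-line -/
def phiS (m : ℕ) : SimpleFunc ℝ ℝ :=
  SimpleFunc.approxOn id measurable_id (Set.Ici 0) 0 (by simp) m

lemma phiS_nonneg (m : ℕ) (t : ℝ) : 0 ≤ phiS m t :=
  SimpleFunc.approxOn_mem measurable_id (s := Set.Ici (0 : ℝ)) (by simp) m t

lemma phiS_range_nonneg (m : ℕ) (x : (phiS m).range) : 0 ≤ (x : ℝ) := by
  obtain ⟨t, ht⟩ := SimpleFunc.mem_range.mp x.2
  rw [← ht]; exact phiS_nonneg m t

lemma phiS_tendsto {t : ℝ} (ht : 0 ≤ t) : Tendsto (fun m => phiS m t) atTop (𝓝 t) :=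
  SimpleFunc.tendsto_approxOn measurable_id (s := Set.Ici (0 : ℝ)) (by simp)
    (subset_closure ht)

lemma simple_int (μ : Measure ℝ) [IsProbabilityMeasure μ] (φ : SimpleFunc ℝ ℝ) (F : ℝ → ℂ) :
    ∫ t, F (φ t) ∂μ = ∑ x : φ.range, ((μ.real (φ ⁻¹' {(x : ℝ)}) : ℝ) : ℂ) * F x := by
  have h1 : ∀ t, F (φ t) = ∑ x ∈ φ.range, (φ ⁻¹' {x}).indicator (fun _ => F x) t := by
    intro t
    rw [Finset.sum_eq_single (φ t)]
    · rw [Set.indicator_of_mem (by simp)]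
    · intro b _ hb
      rw [Set.indicator_of_notMem]
      simpa using hb.symm
    · intro h; exact absurd (SimpleFunc.mem_range_self φ t) h
  simp_rw [h1]
  rw [integral_finsetSum]
  · rw [← Finset.sum_coe_sort]
    apply Finset.sum_congr rfl
    intro x _
    rw [integral_indicator_const _ (φ.measurableSet_fiber _)]
    simp
  · intro x _
    exact (integrable_const _).indicator (φ.measurableSet_fiber _)

lemma St_approx {f : ℂ → ℂ} (hf : IsStieltjesPM f) :
    ∃ w : ∀ m, (phiS m).range → ℝ, (∀ m x, 0 ≤ w m x) ∧ (∀ m, ∑ x, w m x = 1) ∧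
      ∀ z ∈ offRplus,
        Tendsto (fun m => ∑ x, (w m x : ℂ) * (((x : ℝ) : ℂ) - z)⁻¹) atTop (𝓝 (f z)) := by
  obtain ⟨μ, hμ, h0, hE⟩ := hf
  refine ⟨fun m x => μ.real (phiS m ⁻¹' {(x : ℝ)}), fun m x => measureReal_nonneg, ?_, ?_⟩
  · intro m
    have := simple_int μ (phiS m) (fun _ => 1)
    simp only [integral_const, probReal_univ, one_smul, mul_one] at this
    exact_mod_cast this.symm
  · intro z hz
    have e : ∀ m, ∑ x : (phiS m).range, ((μ.real (phiS m ⁻¹' {(x : ℝ)}) : ℝ) : ℂ)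
        * (((x : ℝ) : ℂ) - z)⁻¹ = ∫ t, ((phiS m t : ℂ) - z)⁻¹ ∂μ := fun m =>
      (simple_int μ (phiS m) (fun x => ((x : ℂ) - z)⁻¹)).symm
    simp_rw [e]
    rw [hE z hz]
    obtain ⟨C, hC⟩ := off_bound hz
    apply tendsto_integral_of_dominated_convergence (fun _ => C)
    · intro m
      have : Measurable (fun t => ((phiS m t : ℂ) - z)⁻¹) := by
        have := (phiS m).measurable
        fun_prop
      exact this.aestronglyMeasurable
    · exact integrable_const _
    · intro m
      filter_upwards with t using hC _ (phiS_nonneg m t)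
    · filter_upwards [ae_nonneg_of h0] with t ht
      apply Tendsto.inv₀ _ (off_ne hz ht)
      exact ((Complex.continuous_ofReal.tendsto t).comp (phiS_tendsto ht)).sub_const z

lemma preMat_apply {N n : ℕ} (A : Matrix (Fin N) (Fin n) ℝ) (h : Fin N → ℂ) (g : Fin n → ℂ)
    (z : ℂ) (j l : Fin n) :
    preMat A h g z j l = (if j = l then (g j)⁻¹ else 0)
      - z * ∑ i, (A i j : ℂ) * h i * (A i l : ℂ) := by
  unfold preMat
  rw [Matrix.sub_apply, Matrix.smul_apply, Matrix.diagonal_apply, smul_eq_mul, Matrix.mul_apply]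
  simp [Matrix.mul_diagonal]

lemma preMat_tendsto {N n : ℕ} (A : Matrix (Fin N) (Fin n) ℝ) {H : ℕ → Fin N → ℂ}
    {G : ℕ → Fin n → ℂ} {Z : ℕ → ℂ} {h : Fin N → ℂ} {g : Fin n → ℂ} {z : ℂ}
    (hH : ∀ i, Tendsto (fun m => H m i) atTop (𝓝 (h i)))
    (hG : ∀ i, Tendsto (fun m => G m i) atTop (𝓝 (g i)))
    (hZ : Tendsto Z atTop (𝓝 z)) (hg : ∀ j, g j ≠ 0) (hdet : (preMat A h g z).det ≠ 0)
    (j0 : Fin n) :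
    Tendsto (fun m => (preMat A (H m) (G m) (Z m))⁻¹ j0 j0) atTop
      (𝓝 ((preMat A h g z)⁻¹ j0 j0)) := by
  have h1 : Tendsto (fun m => preMat A (H m) (G m) (Z m)) atTop (𝓝 (preMat A h g z)) := by
    refine tendsto_pi_nhds.mpr fun j => tendsto_pi_nhds.mpr fun l => ?_
    simp_rw [preMat_apply]
    apply Tendsto.sub
    · split_ifs
      · exact (hG j).inv₀ (hg j)
      · exact tendsto_const_nhds
    · apply hZ.mul
      apply tendsto_finsetSum
      intro i _
      exact ((hH i).const_mul _).mul_const _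
  have h2 : ContinuousAt Inv.inv (preMat A h g z) := by
    apply continuousAt_matrix_inv
    rw [Ring.inverse_eq_inv']
    exact continuousAt_inv₀ hdet
  have h3 := h2.tendsto.comp h1
  exact tendsto_pi_nhds.mp (tendsto_pi_nhds.mp h3 j0) j0

lemma Ups_St {N n : ℕ} (A : Matrix (Fin N) (Fin n) ℝ)
    (γ : Fin N → ℂ → ℂ) (γt : Fin n → ℂ → ℂ)
    (hγ : ∀ i, IsStieltjesPM (γ i)) (hγt : ∀ j, IsStieltjesPM (γt j)) (j0 : Fin n) :
    IsStieltjesPM (fun z => Ttmat A γ γt z j0 j0) := by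
  choose p hp hp1 hpl using fun i => St_approx (hγ i)
  choose q hq hq1 hql using fun i => St_approx (hγt i)
  let P : ℕ → Fin N → ℂ → ℂ := fun m i z =>
    ∑ x, (p i m x : ℂ) * (((x : ℝ) : ℂ) - z)⁻¹
  let Q : ℕ → Fin n → ℂ → ℂ := fun m i z =>
    ∑ x, (q i m x : ℂ) * (((x : ℝ) : ℂ) - z)⁻¹
  have hP : ∀ m i, IsStieltjesPM (P m i) := by
    intro m i
    obtain ⟨μ, h1, h2, h3⟩ := isSt_of_sum (p i m) (fun x => (x : ℝ)) (hp i m)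
      (phiS_range_nonneg m) (hp1 i m)
    exact ⟨μ, h1, h2, fun z _ => (h3 (fun t => ((t : ℂ) - z)⁻¹) (by fun_prop)).symm⟩
  have hQ : ∀ m i, IsStieltjesPM (Q m i) := by
    intro m i
    obtain ⟨μ, h1, h2, h3⟩ := isSt_of_sum (q i m) (fun x => (x : ℝ)) (hq i m)
      (phiS_range_nonneg m) (hq1 i m)
    exact ⟨μ, h1, h2, fun z _ => (h3 (fun t => ((t : ℂ) - z)⁻¹) (by fun_prop)).symm⟩
  have hdet : ∀ (γ : Fin N → ℂ → ℂ) (γt : Fin n → ℂ → ℂ), (∀ i, IsStieltjesPM (γ i)) →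
      (∀ j, IsStieltjesPM (γt j)) → ∀ z ∈ offRplus, (∀ j, γt j z ≠ 0) ∧
      (preMat A (fun i => γ i z) (fun j => γt j z) z).det ≠ 0 := by
    intro γ γt hγ hγt z hz
    obtain ⟨c, hc⟩ := exists_sign hz
    exact ⟨fun j => (hc _ (hγt j)).2.2, preMat_det A _ _ z c (fun j => (hc _ (hγt j)).1)
      (fun i => (hc _ (hγ i)).2.1)⟩
  have hnz : ∀ z ∈ offRplus, z ≠ 0 := by
    intro z hz h
    apply hz
    simp [h]
  apply St_limit (f := fun m z => (preMat A (fun i => P m i z) (fun j => Q m j z) z)⁻¹ j0 j0)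
  · intro m
    obtain ⟨μ, h1, h2, h3⟩ := discrete_lem A (fun x : (phiS m).range => (x : ℝ))
      (phiS_range_nonneg m) (fun i => p i m) (fun i => hp i m) (fun i => q i m)
      (fun i => hq i m) (fun i => hq1 i m) j0
    refine ⟨μ, h1, h2, fun z hz => ?_⟩
    have hd := hdet (P m) (Q m) (hP m) (hQ m) z hz
    refine h3 z hz hd.1
      (fun j => (preMat A (fun i => P m i z) (fun j => Q m j z) z)⁻¹ j j0) ?_
    have hinv := Matrix.mul_nonsing_inv (preMat A (fun i => P m i z) (fun j => Q m j z) z)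
      (isUnit_iff_ne_zero.mpr hd.2)
    ext j
    have := congrFun (congrFun hinv j) j0
    rw [Matrix.mul_apply] at this
    rw [Pi.single_apply, ← Matrix.one_apply, ← this]
    rfl
  · intro z hz
    have hd := hdet γ γt hγ hγt z hz
    simp only [Ttmat_eq A γ γt z hd.1]
    exact preMat_tendsto A (fun i => hpl i z hz) (fun j => hql j z hz) tendsto_const_nhds
      hd.1 hd.2 j0
  · have hoff : ∀ m : ℕ, -((m : ℂ) + 1) ∈ offRplus := by
      intro m h
      have := h.2
      simp at this
      have h2 : (0 : ℝ) ≤ m := Nat.cast_nonneg m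
      linarith
    have hone : preMat A (fun _ => 1) (fun _ => 1) 0 = 1 := by
      unfold preMat
      simp
    have key := preMat_tendsto A
      (H := fun m i => ((m : ℂ) + 1) * γ i (-((m : ℂ) + 1)))
      (G := fun m i => ((m : ℂ) + 1) * γt i (-((m : ℂ) + 1)))
      (Z := fun m => -((m : ℂ) + 1)⁻¹) (h := fun _ => 1) (g := fun _ => 1) (z := 0)
      (fun i => St_asymp (hγ i)) (fun i => St_asymp (hγt i))
      (by
        have := tendsto_one_div_add_atTop_nhds_zero_nat (𝕜 := ℂ)
        simpa using this.neg) (by simp) (by rw [hone]; simp) j0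
    rw [hone] at key
    simp only [inv_one, Matrix.one_apply_eq] at key
    refine key.congr ?_
    intro m
    have hd := hdet γ γt hγ hγt _ (hoff m)
    rw [Ttmat_eq A γ γt _ hd.1]
    have hm : (m : ℂ) + 1 ≠ 0 := Nat.cast_add_one_ne_zero m
    have hs : preMat A (fun i => ((m : ℂ) + 1) * γ i (-((m : ℂ) + 1)))
        (fun i => ((m : ℂ) + 1) * γt i (-((m : ℂ) + 1))) (-((m : ℂ) + 1)⁻¹)
        = ((m : ℂ) + 1)⁻¹ • preMat A (fun i => γ i (-((m : ℂ) + 1)))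
        (fun i => γt i (-((m : ℂ) + 1))) (-((m : ℂ) + 1)) := by
      ext j l
      rw [Matrix.smul_apply, preMat_apply, preMat_apply, smul_eq_mul, mul_sub]
      congr 1
      · split_ifs
        · rw [mul_inv]
        · simp
      · rw [Finset.mul_sum, Finset.mul_sum, Finset.mul_sum]
        apply Finset.sum_congr rfl
        intro i _
        ring
    rw [hs]
    have : (((m : ℂ) + 1)⁻¹ • preMat A (fun i => γ i (-((m : ℂ) + 1)))
        (fun i => γt i (-((m : ℂ) + 1))) (-((m : ℂ) + 1)))⁻¹
        = ((m : ℂ) + 1) • (preMat A (fun i => γ i (-((m : ℂ) + 1)))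
        (fun i => γt i (-((m : ℂ) + 1))) (-((m : ℂ) + 1)))⁻¹ := by
      apply Matrix.inv_eq_right_inv
      rw [Matrix.smul_mul, Matrix.mul_smul, smul_smul, inv_mul_cancel₀ hm, one_smul,
        Matrix.mul_nonsing_inv _ (isUnit_iff_ne_zero.mpr hd.2)]
    rw [this]
    rfl

lemma St_second {n : ℕ} (d : Fin n → ℝ) (hd : ∀ j, 0 ≤ d j) (f : Fin n → ℂ → ℂ)
    (hf : ∀ j, IsStieltjesPM (f j)) :
    IsStieltjesPM (fun z => -(z * (1 + ∑ j, (d j : ℂ) * f j z))⁻¹) := by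
  have h0 : IsStieltjesPM (fun z => (0 - z)⁻¹) := by
    refine ⟨Measure.dirac 0, inferInstance, by simp, fun z _ => ?_⟩
    rw [integral_dirac]
    simp
  have := Ups_St (N := n) (n := 1) (Matrix.of fun j _ => √(d j)) f (fun _ z => (0 - z)⁻¹) hf
    (fun _ => h0) 0
  obtain ⟨μ, h1, h2, h3⟩ := this
  refine ⟨μ, h1, h2, fun z hz => ?_⟩
  rw [← h3 z hz]
  have hnz : z ≠ 0 := by
    intro h
    apply hz
    simp [h]
  show -(z * (1 + ∑ j, (d j : ℂ) * f j z))⁻¹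
    = Ttmat (Matrix.of fun j _ => √(d j)) f (fun (_ : Fin 1) z => (0 - z)⁻¹) z 0 0
  rw [Ttmat_eq _ _ _ _ (fun _ => by simpa using hnz), Matrix.inv_subsingleton,
    Matrix.diagonal_apply_eq, Ring.inverse_eq_inv', preMat_apply]
  rw [← inv_neg]
  congr 1
  simp only [if_true, inv_inv, Matrix.of_apply]
  have : ∀ j, ((√(d j) : ℝ) : ℂ) * f j z * ((√(d j) : ℝ) : ℂ) = (d j : ℂ) * f j z := by
    intro j
    have : ((√(d j) : ℝ) : ℂ) * ((√(d j) : ℝ) : ℂ) = (d j : ℂ) := by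
      rw [← Complex.ofReal_mul, Real.mul_self_sqrt (hd j)]
    rw [← this]; ring
  simp_rw [this]
  ring

lemma St_final {N n : ℕ} (c : ℕ) (s : Fin n → ℝ) (A : Matrix (Fin N) (Fin n) ℝ)
    (γ : Fin N → ℂ → ℂ) (γt : Fin n → ℂ → ℂ)
    (hγ : ∀ i, IsStieltjesPM (γ i)) (hγt : ∀ j, IsStieltjesPM (γt j)) :
    IsStieltjesPM (fun z => -(z * (1 + (c : ℂ)⁻¹
      * ((Matrix.diagonal fun j => ((s j : ℂ))^2) * Ttmat A γ γt z).trace))⁻¹) := by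
  have := St_second (fun j => (c : ℝ)⁻¹ * s j ^ 2) (fun j => by positivity)
    (fun j z => Ttmat A γ γt z j j) (fun j => Ups_St A γ γt hγ hγt j)
  convert this using 7 with z
  simp only [Matrix.trace, Matrix.diag_apply, Matrix.diagonal_mul]
  rw [Finset.mul_sum]
  apply Finset.sum_congr rfl
  intro j _
  push_cast
  ring

lemma Tmat_swap {N n : ℕ} (A : Matrix (Fin N) (Fin n) ℝ)
    (γ : Fin N → ℂ → ℂ) (γt : Fin n → ℂ → ℂ) (z : ℂ) :
    Tmat A γ γt z = Ttmat Aᵀ γt γ z := by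
  unfold Tmat Ttmat
  rw [Matrix.transpose_map]
  simp

/-- Proposition 5.1 part 4: the functions
`γ_i⁽²⁾(z) = -1 / (z (1 + n⁻¹ Tr(D̃_i Υ̃(z))))` and
`γ̃_j⁽²⁾(z) = -1 / (z (1 + n⁻¹ Tr(D_j Υ(z))))`
are well defined (their denominators do not vanish) and entrywise holomorphic on
`ℂ ∖ ℝ₊`, and they belong to `S(ℝ₊)`. -/
theorem stmt_8 (N n : ℕ) (hN : 0 < N) (hn : 0 < n)
    (σ : Fin N → Fin n → ℝ) (A : Matrix (Fin N) (Fin n) ℝ)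
    (γ : Fin N → ℂ → ℂ) (γt : Fin n → ℂ → ℂ)
    (hγ : ∀ i, IsStieltjesPM (γ i)) (hγt : ∀ j, IsStieltjesPM (γt j)) :
    (∀ z ∈ offRplus,
      (∀ i : Fin N,
        z * (1 + (n : ℂ)⁻¹
          * ((Matrix.diagonal fun j => ((σ i j : ℂ))^2) * Ttmat A γ γt z).trace) ≠ 0)
      ∧ (∀ j : Fin n,
        z * (1 + (n : ℂ)⁻¹
          * ((Matrix.diagonal fun i => ((σ i j : ℂ))^2) * Tmat A γ γt z).trace) ≠ 0))
    ∧ (∀ i : Fin N,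
        DifferentiableOn ℂ
          (fun z => -(z * (1 + (n : ℂ)⁻¹
            * ((Matrix.diagonal fun j => ((σ i j : ℂ))^2) * Ttmat A γ γt z).trace))⁻¹)
          offRplus
        ∧ IsStieltjesPM (fun z => -(z * (1 + (n : ℂ)⁻¹
            * ((Matrix.diagonal fun j => ((σ i j : ℂ))^2) * Ttmat A γ γt z).trace))⁻¹))
    ∧ (∀ j : Fin n,
        DifferentiableOn ℂ
          (fun z => -(z * (1 + (n : ℂ)⁻¹
            * ((Matrix.diagonal fun i => ((σ i j : ℂ))^2) * Tmat A γ γt z).trace))⁻¹)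
          offRplus
        ∧ IsStieltjesPM (fun z => -(z * (1 + (n : ℂ)⁻¹
            * ((Matrix.diagonal fun i => ((σ i j : ℂ))^2) * Tmat A γ γt z).trace))⁻¹)) := by
  have h1 : ∀ i : Fin N, IsStieltjesPM (fun z => -(z * (1 + (n : ℂ)⁻¹
      * ((Matrix.diagonal fun j => ((σ i j : ℂ))^2) * Ttmat A γ γt z).trace))⁻¹) := fun i =>
    St_final n (fun j => σ i j) A γ γt hγ hγt
  have h2 : ∀ j : Fin n, IsStieltjesPM (fun z => -(z * (1 + (n : ℂ)⁻¹
      * ((Matrix.diagonal fun i => ((σ i j : ℂ))^2) * Tmat A γ γt z).trace))⁻¹) := by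
    intro j
    simp_rw [Tmat_swap]
    exact St_final n (fun i => σ i j) Aᵀ γt γ hγt hγ
  refine ⟨fun z hz => ?_, fun i => ⟨St_diff (h1 i), h1 i⟩, fun j => ⟨St_diff (h2 j), h2 j⟩⟩
  obtain ⟨c, hc⟩ := exists_sign hz
  refine ⟨fun i h => (hc _ (h1 i)).2.2 ?_, fun j h => (hc _ (h2 j)).2.2 ?_⟩
  · simp only [h, _root_.inv_zero, neg_zero]
  · simp only [h, _root_.inv_zero, neg_zero]
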